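/- arXiv:2103.04911 — 2 statements merged into one kernel-verified Lean document; each statement's English description precedes it below -/
import Mathlib

section
/- Let p be a prime and let G be a finite VZ p-group such that d(G') = d(Z(G)). Then c(G) = |G : Z(G)|^{1/2} · c(Z(G)). -/
/-- `quasiPermDegree K G` is the minimal `n ≥ 1` for which there exists an injective
group homomorphism `ρ : G → GL(n, K)` such that the trace of every `ρ g` is a
nonnegative integer. -/
noncomputable def quasiPermDegree (K : Type) [Field K] (G : Type) [Group G] : ℕ :=
  sInf {n : ℕ | 0 < n ∧ ∃ ρ : G →* Matrix.GeneralLinearGroup (Fin n) K,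
    Function.Injective ρ ∧
      ∀ g : G, ∃ m : ℕ, Matrix.trace ((ρ g : Matrix (Fin n) (Fin n) K)) = (m : K)}

/-- `c(G)`: minimal degree of a faithful quasi-permutation representation over `ℂ`. -/
noncomputable def cDeg (G : Type) [Group G] : ℕ := quasiPermDegree ℂ G

/-- `q(G)`: minimal degree of a faithful quasi-permutation representation over `ℚ`. -/
noncomputable def qDeg (G : Type) [Group G] : ℕ := quasiPermDegree ℚ G

/-- `μ(G)`: minimal degree of a faithful permutation representation of `G`. -/
noncomputable def muDeg (G : Type) [Group G] : ℕ :=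
  sInf {n : ℕ | ∃ f : G →* Equiv.Perm (Fin n), Function.Injective f}

/-- A finite group is a VZ-group if every irreducible complex character of degree `> 1`
vanishes off the center. -/
def IsVZGroup (G : Type) [Group G] : Prop :=
  ∀ V : FDRep ℂ G, CategoryTheory.Simple V → 1 < Module.finrank ℂ V →
    ∀ g : G, g ∉ Subgroup.center G → V.character g = 0

/-- A group is a Camina group if for every `g ∉ G'`, the coset `gG'` is contained in the
conjugacy class of `g`. -/
def IsCaminaGroup (G : Type) [Group G] : Prop :=
  ∀ g : G, g ∉ commutator G → ∀ h ∈ commutator G, IsConj g (g * h)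

namespace Representation

variable {G : Type} [Group G]

theorem trace_eq_add_of_isCompl {V : Type} [AddCommGroup V] [Module ℂ V] [FiniteDimensional ℂ V]
    (ρ : Representation ℂ G V) {W W' : Subrepresentation ρ} (h : IsCompl W W') (g : G) :
    LinearMap.trace ℂ V (ρ g) =
      LinearMap.trace ℂ W.toSubmodule (W.toRepresentation g) +
        LinearMap.trace ℂ W'.toSubmodule (W'.toRepresentation g) := by
  have hc : IsCompl W.toSubmodule W'.toSubmodule := by
    constructor
    · rw [disjoint_iff, ← Subrepresentation.toSubmodule_inf, h.inf_eq_bot]; rfl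
    · rw [codisjoint_iff, ← Subrepresentation.toSubmodule_sup, h.sup_eq_top]; rfl
  let N : Bool → Submodule ℂ V := fun b ↦ cond b W.toSubmodule W'.toSubmodule
  have hN : DirectSum.IsInternal N := by
    rw [DirectSum.isInternal_submodule_iff_isCompl N (i := true) (j := false) (by simp)
      (by ext b; cases b <;> simp)]
    exact hc
  have hf : ∀ b, Set.MapsTo (ρ g) (N b) (N b) := by
    rintro (_ | _)
    · exact fun v hv ↦ W'.apply_mem_toSubmodule g hv
    · exact fun v hv ↦ W.apply_mem_toSubmodule g hv
  rw [LinearMap.trace_eq_sum_trace_restrict hN hf, Fintype.sum_bool]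
  rfl

theorem finrank_eq_add_of_isCompl {V : Type} [AddCommGroup V] [Module ℂ V]
    [FiniteDimensional ℂ V] (ρ : Representation ℂ G V) {W W' : Subrepresentation ρ}
    (h : IsCompl W W') :
    Module.finrank ℂ V = Module.finrank ℂ W.toSubmodule + Module.finrank ℂ W'.toSubmodule := by
  have := ρ.trace_eq_add_of_isCompl h 1
  simp only [map_one, LinearMap.trace_one] at this
  exact_mod_cast this

/-- A property of finite-dimensional complex representations of a finite group that holds for the
zero representation and for irreducible ones, and that passes to direct sums, holds always. -/
theorem induction_on_irreducible [Finite G]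
    (P : ∀ (V : Type) [AddCommGroup V] [Module ℂ V] [FiniteDimensional ℂ V],
      Representation ℂ G V → Prop)
    (zero : ∀ (V : Type) [AddCommGroup V] [Module ℂ V] [FiniteDimensional ℂ V]
      (ρ : Representation ℂ G V), Subsingleton V → P V ρ)
    (irreducible : ∀ (V : Type) [AddCommGroup V] [Module ℂ V] [FiniteDimensional ℂ V]
      (ρ : Representation ℂ G V), ρ.IsIrreducible → P V ρ)
    (add : ∀ (V : Type) [AddCommGroup V] [Module ℂ V] [FiniteDimensional ℂ V]
      (ρ : Representation ℂ G V) (W W' : Subrepresentation ρ), IsCompl W W' →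
      P W.toSubmodule W.toRepresentation → P W'.toSubmodule W'.toRepresentation → P V ρ)
    (V : Type) [AddCommGroup V] [Module ℂ V] [FiniteDimensional ℂ V]
    (ρ : Representation ℂ G V) : P V ρ := by
  induction hn : Module.finrank ℂ V using Nat.strong_induction_on generalizing V with
  | _ n ih =>
  rcases subsingleton_or_nontrivial V with hV | hV
  · exact zero V ρ hV
  by_cases hirr : ρ.IsIrreducible
  · exact irreducible V ρ hirr
  have hbt : (⊥ : Subrepresentation ρ) ≠ ⊤ := by
    intro hb
    have : (⊥ : Submodule ℂ V) = ⊤ := congrArg Subrepresentation.toSubmodule hb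
    exact bot_ne_top this
  have : Nontrivial (Subrepresentation ρ) := ⟨⊥, ⊤, hbt⟩
  obtain ⟨W, hW0, hW1⟩ : ∃ W : Subrepresentation ρ, W ≠ ⊥ ∧ W ≠ ⊤ := by
    by_contra! hcon
    exact hirr ⟨fun W ↦ or_iff_not_imp_left.2 (hcon W)⟩
  obtain ⟨W', hc⟩ := exists_isCompl W
  have hpos : ∀ U : Subrepresentation ρ, U ≠ ⊥ → 0 < Module.finrank ℂ U.toSubmodule := by
    intro U hU
    rw [Nat.pos_iff_ne_zero, Ne, Submodule.finrank_eq_zero]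
    exact fun h ↦ hU (Subrepresentation.toSubmodule_injective h)
  have hW' : W' ≠ ⊥ := by
    rintro rfl
    exact hW1 (by simpa using hc.sup_eq_top)
  have hsum := ρ.finrank_eq_add_of_isCompl hc
  have h1 := hpos W hW0
  have h2 := hpos W' hW'
  exact add V ρ W W' hc (ih _ (by omega) _ _ rfl) (ih _ (by omega) _ _ rfl)

/-- A representation on which the character `χ` of a subgroup acts by scalars. -/
def HasCentralCharacter {H : Subgroup G} {V : Type} [AddCommGroup V] [Module ℂ V]
    (ρ : Representation ℂ G V) (χ : H →* ℂˣ) : Prop :=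
  ∀ (z : H) (v : V), ρ z v = (χ z : ℂ) • v

theorem HasCentralCharacter.toRepresentation {H : Subgroup G} {V : Type} [AddCommGroup V]
    [Module ℂ V] {ρ : Representation ℂ G V} {χ : H →* ℂˣ} (h : ρ.HasCentralCharacter χ)
    (W : Subrepresentation ρ) : W.toRepresentation.HasCentralCharacter χ :=
  fun z v ↦ Subtype.ext (h z v)

theorem exists_irreducible_hasCentralCharacter [Finite G] {H : Subgroup G} (χ : H →* ℂˣ) {V : Type}
    [AddCommGroup V] [Module ℂ V] [FiniteDimensional ℂ V] (hV : Nontrivial V)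
    (ρ : Representation ℂ G V) (hρ : ρ.HasCentralCharacter χ) :
    ∃ (U : Type) (_ : AddCommGroup U) (_ : Module ℂ U) (_ : FiniteDimensional ℂ U)
      (σ : Representation ℂ G U), σ.IsIrreducible ∧ σ.HasCentralCharacter χ := by
  revert hV hρ
  refine induction_on_irreducible (fun V _ _ _ ρ ↦ Nontrivial V → ρ.HasCentralCharacter χ →
    ∃ (U : Type) (_ : AddCommGroup U) (_ : Module ℂ U) (_ : FiniteDimensional ℂ U)
      (σ : Representation ℂ G U), σ.IsIrreducible ∧ σ.HasCentralCharacter χ) ?_ ?_ ?_ V ρ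
  · intro V _ _ _ ρ h h'
    exact absurd h (not_subsingleton V)
  · exact fun V _ _ _ ρ h _ h' ↦ ⟨V, _, _, ‹_›, ρ, h, h'⟩
  · intro V _ _ _ ρ W W' hc h h' hV hρ
    have hd := ρ.finrank_eq_add_of_isCompl hc
    have hpos : 0 < Module.finrank ℂ V := Module.finrank_pos
    rcases Nat.eq_zero_or_pos (Module.finrank ℂ W.toSubmodule) with h0 | h0
    · exact h' (Module.nontrivial_of_finrank_pos (R := ℂ) (by omega)) (hρ.toRepresentation W')
    · exact h (Module.nontrivial_of_finrank_pos (R := ℂ) h0) (hρ.toRepresentation W)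

theorem exists_nontrivial_hasCentralCharacter [Finite G] {H : Subgroup G}
    (χ : H →* ℂˣ) :
    ∃ (U : Type) (_ : AddCommGroup U) (_ : Module ℂ U) (_ : FiniteDimensional ℂ U)
      (σ : Representation ℂ G U), Nontrivial U ∧ (H ≤ Subgroup.center G →
        σ.HasCentralCharacter χ) := by
  classical
  let U : Submodule ℂ (G → ℂ) :=
    { carrier := {f | ∀ (z : H) (x : G), f (z * x) = χ z * f x}
      add_mem' := fun {a b} ha hb z x ↦ by simp [ha z x, hb z x, mul_add]
      zero_mem' := fun z x ↦ by simp
      smul_mem' := fun c f hf z x ↦ by simp [hf z x, mul_left_comm] }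
  let σ : Representation ℂ G U :=
    { toFun := fun g ↦
        { toFun := fun f ↦ ⟨fun x ↦ f.1 (x * g), fun z x ↦ by
            simpa only [mul_assoc] using f.2 z (x * g)⟩
          map_add' := fun _ _ ↦ rfl
          map_smul' := fun _ _ ↦ rfl }
      map_one' := by ext f x; simp
      map_mul' := fun g h ↦ by ext f x; simp [mul_assoc] }
  refine ⟨U, inferInstance, inferInstance, inferInstance, σ, ?_, ?_⟩
  · let f : U := ⟨fun x ↦ if hx : x ∈ H then χ ⟨x, hx⟩ else 0, fun z x ↦ by
      by_cases hx : x ∈ H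
      · have hzx : (z : G) * x ∈ H := H.mul_mem z.2 hx
        simp only [hx, hzx, dif_pos]
        rw [← Units.val_mul, ← map_mul]
        rfl
      · have hzx : (z : G) * x ∉ H := fun h ↦ hx ((H.mul_mem_cancel_left z.2).1 h)
        simp [hx, hzx]⟩
    refine ⟨f, 0, fun h ↦ ?_⟩
    have := congrFun (congrArg Subtype.val h) 1
    simp only [f, H.one_mem, dif_pos] at this
    exact Units.ne_zero _ this
  · intro hH z f
    ext x
    change f.1 (x * z) = χ z * f.1 x
    rw [(Subgroup.mem_center_iff.1 (hH z.2) x), f.2]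

end Representation

namespace Representation

variable {G : Type} [Group G] {V : Type} [AddCommGroup V] [Module ℂ V]

theorem IsIrreducible.nontrivial {ρ : Representation ℂ G V} (hρ : ρ.IsIrreducible) :
    Nontrivial V := by
  by_contra hV
  rw [not_nontrivial_iff_subsingleton] at hV
  have := hρ.toNontrivial
  refine bot_ne_top (α := Subrepresentation ρ) (Subrepresentation.toSubmodule_injective ?_)
  exact Subsingleton.elim _ _

theorem apply_eq_one_of_finrank_eq_one (ρ : Representation ℂ G V) (h : Module.finrank ℂ V = 1)
    {g : G} (hg : g ∈ commutator G) : ρ g = 1 := by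
  have hcomm : ∀ a b : Module.End ℂ V, a * b = b * a := by
    intro a b
    obtain ⟨v, hv, hspan⟩ := finrank_eq_one_iff'.1 h
    obtain ⟨x, hx⟩ := hspan (a v)
    obtain ⟨y, hy⟩ := hspan (b v)
    ext w
    obtain ⟨c, rfl⟩ := hspan w
    simp [← hx, ← hy, smul_comm x y]
  let f : G →* (Module.End ℂ V)ˣ := ρ.toHomUnits
  have hle : commutator G ≤ f.ker := by
    rw [commutator_def, Subgroup.commutator_le]
    intro a _ b _
    rw [MonoidHom.mem_ker, map_commutatorElement, commutatorElement_eq_one_iff_mul_comm]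
    exact Units.ext (hcomm _ _)
  exact congrArg Units.val (MonoidHom.mem_ker.1 (hle hg))

theorem HasCentralCharacter.trace_center [FiniteDimensional ℂ V] {ρ : Representation ℂ G V}
    {χ : Subgroup.center G →* ℂˣ} (hχ : ρ.HasCentralCharacter χ) (z : Subgroup.center G) :
    LinearMap.trace ℂ V (ρ z) = χ z * Module.finrank ℂ V := by
  have : ρ z = (χ z : ℂ) • (1 : Module.End ℂ V) := by
    ext v
    exact hχ z v
  rw [this, map_smul, LinearMap.trace_one, smul_eq_mul]

theorem IsIrreducible.one_lt_finrank [FiniteDimensional ℂ V] {ρ : Representation ℂ G V}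
    (hρ : ρ.IsIrreducible)
    {χ : Subgroup.center G →* ℂˣ} (hχ : ρ.HasCentralCharacter χ)
    {w : Subgroup.center G} (hw : (w : G) ∈ commutator G) (hχw : χ w ≠ 1) :
    1 < Module.finrank ℂ V := by
  have := hρ.nontrivial
  have hpos : 0 < Module.finrank ℂ V := Module.finrank_pos
  refine lt_of_le_of_ne hpos fun h1 ↦ hχw ?_
  obtain ⟨v, hv⟩ := exists_ne (0 : V)
  have h2 := hχ w v
  rw [ρ.apply_eq_one_of_finrank_eq_one h1.symm hw, Module.End.one_apply] at h2
  have h3 : ((χ w : ℂ) - 1) • v = 0 := by rw [sub_smul, ← h2, one_smul, sub_self]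
  ext
  simpa [hv, sub_eq_zero] using h3

variable [Fintype G] [FiniteDimensional ℂ V]

theorem IsIrreducible.sum_character_mul_character_inv {ρ : Representation ℂ G V}
    (hρ : ρ.IsIrreducible) :
    ∑ g : G, ρ.character g * ρ.character g⁻¹ = Nat.card G := by
  have hG : (Nat.card G : ℂ) ≠ 0 := by simp
  have : Invertible (Nat.card G : ℂ) := invertibleOfNonzero hG
  have h := char_orthonormal ρ ρ
  rw [if_pos ⟨Representation.Equiv.refl ρ⟩, inv_mul_eq_one₀ hG] at h
  exact h.symm

theorem IsIrreducible.simple_of {ρ : Representation ℂ G V} (hρ : ρ.IsIrreducible) :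
    CategoryTheory.Simple (FDRep.of ρ) := by
  rw [FDRep.simple_iff_char_is_norm_one]
  exact hρ.sum_character_mul_character_inv

variable (hVZ : IsVZGroup G)
include hVZ

theorem IsIrreducible.character_eq_zero {ρ : Representation ℂ G V} (hρ : ρ.IsIrreducible)
    (h : 1 < Module.finrank ℂ V) {g : G} (hg : g ∉ Subgroup.center G) :
    LinearMap.trace ℂ V (ρ g) = 0 :=
  hVZ (FDRep.of ρ) hρ.simple_of h g hg

theorem IsIrreducible.finrank_mul_finrank {ρ : Representation ℂ G V} (hρ : ρ.IsIrreducible)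
    {χ : Subgroup.center G →* ℂˣ} (hχ : ρ.HasCentralCharacter χ)
    {w : Subgroup.center G} (hw : (w : G) ∈ commutator G) (hχw : χ w ≠ 1) :
    Module.finrank ℂ V * Module.finrank ℂ V = (Subgroup.center G).index := by
  classical
  have h1 := hρ.one_lt_finrank hχ hw hχw
  have hsum := hρ.sum_character_mul_character_inv
  have hcen : ∑ g : G, ρ.character g * ρ.character g⁻¹ =
      ∑ z : Subgroup.center G, ρ.character z * ρ.character (z : G)⁻¹ := by
    rw [← Finset.sum_subtype (Finset.univ.filter (· ∈ Subgroup.center G)) (by simp)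
      (fun g ↦ ρ.character g * ρ.character g⁻¹)]
    refine (Finset.sum_filter_of_ne fun g _ hg ↦ ?_).symm
    by_contra hgz
    exact hg (by rw [character, hρ.character_eq_zero hVZ h1 hgz, zero_mul])
  have hz : ∀ z : Subgroup.center G, ρ.character z * ρ.character (z : G)⁻¹ =
      (Module.finrank ℂ V * Module.finrank ℂ V : ℂ) := by
    intro z
    have e1 := hχ.trace_center z
    have e2 := hχ.trace_center z⁻¹
    rw [map_inv, InvMemClass.coe_inv] at e2
    rw [character, character, e1, e2]
    have := (χ z).ne_zero
    rw [Units.val_inv_eq_inv_val]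
    field_simp
  rw [hcen, Finset.sum_congr rfl fun z _ ↦ hz z] at hsum
  simp only [Finset.sum_const, Finset.card_univ, nsmul_eq_mul] at hsum
  rw [← Nat.card_eq_fintype_card, ← (Subgroup.center G).card_mul_index] at hsum
  have hpos : (Nat.card (Subgroup.center G) : ℂ) ≠ 0 := by simp
  push_cast at hsum
  exact_mod_cast mul_left_cancel₀ hpos hsum

theorem HasCentralCharacter.dvd_finrank {e : ℕ} (he : e * e = (Subgroup.center G).index)
    {ρ : Representation ℂ G V}
    {χ : Subgroup.center G →* ℂˣ} (hχ : ρ.HasCentralCharacter χ)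
    {w : Subgroup.center G} (hw : (w : G) ∈ commutator G) (hχw : χ w ≠ 1) :
    e ∣ Module.finrank ℂ V := by
  revert hχ
  refine induction_on_irreducible (fun V _ _ _ ρ ↦ ρ.HasCentralCharacter χ →
    e ∣ Module.finrank ℂ V) ?_ ?_ ?_ V ρ
  · intro V _ _ _ ρ h _
    simp [Module.finrank_zero_of_subsingleton]
  · intro V _ _ _ ρ h hχ
    have := h.finrank_mul_finrank hVZ hχ hw hχw
    rw [← he, Nat.mul_self_inj] at this
    rw [this]
  · intro V _ _ _ ρ W W' hc h h' hχ
    rw [ρ.finrank_eq_add_of_isCompl hc]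
    exact dvd_add (h (hχ.toRepresentation W)) (h' (hχ.toRepresentation W'))

end Representation

open scoped IsMulCommutative in
theorem IsVZGroup.exists_mul_self_eq_index {G : Type} [Group G] [Fintype G] (hVZ : IsVZGroup G)
    {w : Subgroup.center G} (hw : (w : G) ∈ commutator G) (h1 : w ≠ 1) :
    ∃ e : ℕ, e * e = (Subgroup.center G).index := by
  obtain ⟨χ, hχ⟩ := CommGroup.exists_apply_ne_one_of_hasEnoughRootsOfUnity
    (Subgroup.center G) ℂ h1
  obtain ⟨V, _, _, _, ρ, hV, hρ⟩ := Representation.exists_nontrivial_hasCentralCharacter χ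
  obtain ⟨U, _, _, _, σ, hσ, hσχ⟩ :=
    ρ.exists_irreducible_hasCentralCharacter χ hV (hρ le_rfl)
  exact ⟨_, hσ.finrank_mul_finrank hVZ hσχ hw hχ⟩

theorem IsVZGroup.exists_matrix_representation {G : Type} [Group G] [Fintype G]
    (hVZ : IsVZGroup G) {e : ℕ} (he : e * e = (Subgroup.center G).index)
    {w : Subgroup.center G} (hw : (w : G) ∈ commutator G) {χ : Subgroup.center G →* ℂˣ}
    (hχ : χ w ≠ 1) :
    ∃ R : G →* Matrix (Fin e) (Fin e) ℂ,
      (∀ z : Subgroup.center G, R z = (χ z : ℂ) • 1) ∧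
        ∀ g ∉ Subgroup.center G, (R g).trace = 0 := by
  obtain ⟨V, _, _, _, ρ, hV, hρ⟩ := Representation.exists_nontrivial_hasCentralCharacter χ
  obtain ⟨U, _, _, _, σ, hσ, hσχ⟩ :=
    ρ.exists_irreducible_hasCentralCharacter χ hV (hρ le_rfl)
  have hd : Module.finrank ℂ U = e := by
    have := hσ.finrank_mul_finrank hVZ hσχ hw hχ
    rwa [← he, Nat.mul_self_inj] at this
  let b := Module.finBasisOfFinrankEq ℂ U hd
  refine ⟨(LinearMap.toMatrixAlgEquiv b : _ →* _).comp σ, fun z ↦ ?_, fun g hg ↦ ?_⟩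
  · have : σ z = (χ z : ℂ) • (1 : Module.End ℂ U) := by
      ext v
      exact hσχ z v
    simp [this]
  · change (LinearMap.toMatrix b b (σ g)).trace = 0
    rw [← LinearMap.trace_eq_matrix_trace ℂ b]
    exact hσ.character_eq_zero hVZ (hσ.one_lt_finrank hσχ hw hχ) hg

theorem IsVZGroup.commutator_le_center {G : Type} [Group G] [Fintype G] (hVZ : IsVZGroup G) :
    commutator G ≤ Subgroup.center G := by
  classical
  intro g hg
  by_contra hgz
  have key : ∀ (V : Type) [AddCommGroup V] [Module ℂ V] [FiniteDimensional ℂ V]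
      (ρ : Representation ℂ G V), ∃ m : ℕ, LinearMap.trace ℂ V (ρ g) = m := by
    intro V _ _ _ ρ
    refine Representation.induction_on_irreducible
      (fun V _ _ _ ρ ↦ ∃ m : ℕ, LinearMap.trace ℂ V (ρ g) = m) ?_ ?_ ?_ V ρ
    · intro V _ _ _ ρ h
      exact ⟨0, by rw [Subsingleton.elim (ρ g) 0]; simp⟩
    · intro V _ _ _ ρ h
      by_cases h1 : Module.finrank ℂ V = 1
      · exact ⟨1, by rw [ρ.apply_eq_one_of_finrank_eq_one h1 hg]; simp [h1]⟩
      · have := h.nontrivial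
        have hpos : 0 < Module.finrank ℂ V := Module.finrank_pos
        exact ⟨0, by rw [h.character_eq_zero hVZ (by omega) hgz]; simp⟩
    · rintro V _ _ _ ρ W W' hc ⟨m, hm⟩ ⟨m', hm'⟩
      exact ⟨m + m', by rw [ρ.trace_eq_add_of_isCompl hc, hm, hm']; push_cast; rfl⟩
  let ρ : Representation ℂ G (G → ℂ) :=
    { toFun := fun h ↦ LinearMap.funLeft ℂ ℂ (· * h)
      map_one' := by ext f x; simp [LinearMap.funLeft]
      map_mul' := fun a b ↦ by ext f x; simp [LinearMap.funLeft, mul_assoc] }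
  have htr : LinearMap.trace ℂ _ (ρ g) = 0 := by
    have hg1 : g ≠ 1 := fun h ↦ hgz (h ▸ Subgroup.one_mem _)
    rw [LinearMap.trace_eq_matrix_trace ℂ (Pi.basisFun ℂ G), Matrix.trace]
    refine Finset.sum_eq_zero fun x _ ↦ ?_
    simp [ρ, LinearMap.funLeft, hg1]
  let W : Subrepresentation ρ :=
    { toSubmodule := ℂ ∙ (fun _ ↦ 1 : G → ℂ)
      apply_mem_toSubmodule := by
        intro h v hv
        obtain ⟨c, rfl⟩ := Submodule.mem_span_singleton.1 hv
        exact Submodule.mem_span_singleton.2 ⟨c, by ext; simp [ρ, LinearMap.funLeft]⟩ }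
  obtain ⟨W', hc⟩ := exists_isCompl W
  have hW : LinearMap.trace ℂ W.toSubmodule (W.toRepresentation g) = 1 := by
    have h1 : Module.finrank ℂ W.toSubmodule = 1 :=
      finrank_span_singleton (fun h ↦ one_ne_zero (congrFun h 1))
    rw [Representation.apply_eq_one_of_finrank_eq_one _ h1 hg]
    simp [h1]
  obtain ⟨m, hm⟩ := key _ W'.toRepresentation
  rw [ρ.trace_eq_add_of_isCompl hc, hW, hm] at htr
  norm_cast at htr
  omega

namespace CommGroup

variable {A : Type} [CommGroup A] [Finite A] {p : ℕ}

theorem card_ker_powMonoidHom (A : Type) [CommGroup A] [Finite A] (p : ℕ) :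
    Nat.card (powMonoidHom p : A →* A).ker = (powMonoidHom p : A →* A).range.index := by
  have h1 := Subgroup.card_mul_index (powMonoidHom p : A →* A).ker
  have h2 := Subgroup.card_mul_index (powMonoidHom p : A →* A).range
  rw [Subgroup.index_ker, ← h2, mul_comm] at h1
  exact mul_left_cancel₀ Nat.card_pos.ne' h1

theorem card_ker_powMonoidHom_le (A : Type) [CommGroup A] [Finite A] (hp : 0 < p) :
    Nat.card (powMonoidHom p : A →* A).ker ≤ p ^ Group.rank A := by
  rw [card_ker_powMonoidHom]
  let R := (powMonoidHom p : A →* A).range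
  change Nat.card (A ⧸ R) ≤ _
  have hexp : Monoid.exponent (A ⧸ R) ∣ p := by
    refine Monoid.exponent_dvd_of_forall_pow_eq_one fun q ↦ ?_
    obtain ⟨a, rfl⟩ := QuotientGroup.mk_surjective q
    exact (QuotientGroup.eq_one_iff _).2 ⟨a, rfl⟩
  have hrank : Group.rank (A ⧸ R) ≤ Group.rank A :=
    Group.rank_le_of_surjective (QuotientGroup.mk' R) (QuotientGroup.mk'_surjective R)
  refine Nat.le_of_dvd (pow_pos hp _) ?_
  exact (card_dvd_exponent_pow_rank (A ⧸ R)).trans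
    ((pow_dvd_pow_of_dvd hexp _).trans (pow_dvd_pow p hrank))

theorem rank_pi_zmod_le {ι : Type} [Fintype ι] (n : ι → ℕ) [∀ i, NeZero (n i)] :
    Group.rank (∀ i, Multiplicative (ZMod (n i))) ≤ Fintype.card ι := by
  classical
  let S : Finset (∀ i, Multiplicative (ZMod (n i))) :=
    Finset.univ.image fun i ↦ Pi.mulSingle i (Multiplicative.ofAdd 1)
  have hS : Subgroup.closure (S : Set (∀ i, Multiplicative (ZMod (n i)))) = ⊤ := by
    rw [eq_top_iff]
    intro f _
    rw [← Finset.univ_prod_mulSingle f]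
    refine Subgroup.prod_mem _ fun i _ ↦ ?_
    have : Pi.mulSingle i (f i) =
        (Pi.mulSingle i (Multiplicative.ofAdd 1) : ∀ i, Multiplicative (ZMod (n i))) ^
          (f i).toAdd.val := by
      rw [← Pi.mulSingle_pow]
      congr 1
      rw [← ofAdd_nsmul, nsmul_eq_mul, mul_one, ZMod.natCast_zmod_val]
      rfl
    rw [this]
    exact Subgroup.pow_mem _ (Subgroup.subset_closure (by simp [S])) _
  exact (Group.rank_le hS).trans Finset.card_image_le

theorem pow_rank_le_card_ker_powMonoidHom [hp : Fact p.Prime] (hA : IsPGroup p A) :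
    p ^ Group.rank A ≤ Nat.card (powMonoidHom p : A →* A).ker := by
  classical
  obtain ⟨ι, _, n, hn, ⟨f⟩⟩ := CommGroup.equiv_prod_multiplicative_zmod_of_finite A
  have : ∀ i, NeZero (n i) := fun i ↦ NeZero.of_gt (hn i)
  have hex : ∀ i, ∃ x : Multiplicative (ZMod (n i)), orderOf x = p := by
    intro i
    refine exists_prime_orderOf_dvd_card' p ?_
    have hB : IsPGroup p (Multiplicative (ZMod (n i))) :=
      hA.of_surjective ((Pi.evalMonoidHom _ i).comp f.toMonoidHom)
        ((Function.surjective_eval i).comp f.surjective)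
    have : Nontrivial (Multiplicative (ZMod (n i))) := by
      have : Fact (1 < n i) := ⟨hn i⟩
      infer_instance
    obtain ⟨k, hk, hcard⟩ := hB.nontrivial_iff_card.1 this
    rw [hcard]
    exact dvd_pow_self p hk.ne'
  choose x hx using hex
  let g : (ι → Fin p) → (powMonoidHom p : A →* A).ker := fun k ↦
    ⟨f.symm fun i ↦ x i ^ (k i : ℕ), by
      rw [MonoidHom.mem_ker, powMonoidHom_apply, ← map_pow, map_eq_one_iff _ f.symm.injective]
      ext1 i
      have hxp : x i ^ p = 1 := by simpa only [hx i] using pow_orderOf_eq_one (x i)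
      rw [Pi.pow_apply, ← pow_mul, mul_comm, pow_mul, hxp, one_pow, Pi.one_apply]⟩
  have hg : Function.Injective g := by
    intro k l hkl
    have h1 := f.symm.injective (congrArg Subtype.val hkl)
    funext i
    have h2 := congrFun h1 i
    exact Fin.ext (pow_injOn_Iio_orderOf (by simp [hx i]) (by simp [hx i]) h2)
  calc p ^ Group.rank A = p ^ Group.rank (∀ i, Multiplicative (ZMod (n i))) := by
        rw [Group.rank_congr f]
    _ ≤ p ^ Fintype.card ι := Nat.pow_le_pow_right hp.out.pos (rank_pi_zmod_le n)
    _ = Nat.card (ι → Fin p) := by simp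
    _ ≤ _ := Nat.card_le_card_of_injective g hg

end CommGroup

open scoped IsMulCommutative in
/-- A central subgroup `K` of a finite `p`-group `G` whose rank equals that of the center contains
all central elements of order dividing `p`. -/
theorem IsPGroup.mem_of_rank_eq_rank_center {G : Type} [Group G] [Finite G] {p : ℕ}
    [hp : Fact p.Prime] (hG : IsPGroup p G) {K : Subgroup G} (hK : K ≤ Subgroup.center G)
    (h : Group.rank K = Group.rank (Subgroup.center G)) {w : G} (hw : w ∈ Subgroup.center G)
    (hwp : w ^ p = 1) : w ∈ K := by
  have : IsMulCommutative K := ⟨⟨fun a b ↦ Subtype.ext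
    (Subgroup.mem_center_iff.1 (hK b.2) a)⟩⟩
  let g : (powMonoidHom p : K →* K).ker → (powMonoidHom p : Subgroup.center G →* _).ker :=
    fun k ↦ ⟨⟨k.1.1, hK k.1.2⟩, by
      have hk := k.2
      rw [MonoidHom.mem_ker, powMonoidHom_apply] at hk ⊢
      exact Subtype.ext (show (k.1 : G) ^ p = 1 from congrArg (fun t : K ↦ (t : G)) hk)⟩
  have hg : Function.Injective g := fun a b hab ↦
    Subtype.ext (Subtype.ext (congrArg (fun t ↦ t.1.1) hab))
  have hcard := (CommGroup.card_ker_powMonoidHom_le (Subgroup.center G) hp.out.pos).trans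
    (h ▸ CommGroup.pow_rank_le_card_ker_powMonoidHom (hG.to_subgroup K))
  have hsurj := hg.bijective_of_nat_card_le hcard
  obtain ⟨k, hk⟩ := hsurj.2 ⟨⟨w, hw⟩, by
    rw [MonoidHom.mem_ker, powMonoidHom_apply]
    exact Subtype.ext hwp⟩
  have : k.1.1 = w := congrArg (fun t ↦ t.1.1) hk
  exact this ▸ k.1.2

section WeightSpaces

variable {Z : Type} [CommGroup Z] [Fintype Z]

/-- The subspace on which the abelian group `Z` acts through the character `χ`. -/
def Representation.weightSpace {V : Type} [AddCommGroup V] [Module ℂ V]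
    (ρ : Representation ℂ Z V) (χ : Z →* ℂˣ) : Submodule ℂ V where
  carrier := {v | ∀ z, ρ z v = (χ z : ℂ) • v}
  add_mem' ha hb z := by rw [map_add, ha z, hb z, smul_add]
  zero_mem' z := by simp
  smul_mem' c v hv z := by rw [map_smul, hv z, smul_comm]

theorem Representation.card_mul_finrank_weightSpace {V : Type} [AddCommGroup V] [Module ℂ V]
    [FiniteDimensional ℂ V] (ρ : Representation ℂ Z V) (χ : Z →* ℂˣ) :
    (Nat.card Z : ℂ) * Module.finrank ℂ (ρ.weightSpace χ) =
      ∑ z, ((χ⁻¹ z : ℂˣ) : ℂ) * LinearMap.trace ℂ V (ρ z) := by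
  let τ : Representation ℂ Z V :=
    { toFun := fun z ↦ ((χ⁻¹ z : ℂˣ) : ℂ) • ρ z
      map_one' := by simp
      map_mul' := fun a b ↦ by
        rw [map_mul, map_mul, Units.val_mul, smul_mul_smul_comm] }
  have hcard : (Nat.card Z : ℂ) ≠ 0 := by simp
  have : Invertible (Nat.card Z : ℂ) := invertibleOfNonzero hcard
  have hτ : τ.invariants = ρ.weightSpace χ := by
    ext v
    refine forall_congr' fun z ↦ ?_
    change ((χ⁻¹ z : ℂˣ) : ℂ) • ρ z v = v ↔ _
    rw [MonoidHom.inv_apply, ← Units.smul_def, inv_smul_eq_iff, Units.smul_def]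
  have h := τ.card_inv_mul_sum_char_eq_finrank
  rw [hτ, inv_mul_eq_iff_eq_mul₀ hcard] at h
  rw [← h]
  refine Finset.sum_congr rfl fun z _ ↦ ?_
  change LinearMap.trace ℂ V (((χ⁻¹ z : ℂˣ) : ℂ) • ρ z) = _
  rw [map_smul, smul_eq_mul]

theorem CommGroup.sum_character_apply [Fintype (Z →* ℂˣ)] [DecidableEq Z] (z : Z) :
    ∑ χ : Z →* ℂˣ, (χ z : ℂ) = if z = 1 then (Nat.card Z : ℂ) else 0 := by
  split_ifs with hz
  · subst hz
    simp only [map_one, Units.val_one, Finset.sum_const, Finset.card_univ, nsmul_eq_mul, mul_one,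
      ← Nat.card_eq_fintype_card]
    rw [CommGroup.card_monoidHom_of_hasEnoughRootsOfUnity Z ℂ]
  · obtain ⟨φ, hφ⟩ := CommGroup.exists_apply_ne_one_of_hasEnoughRootsOfUnity Z ℂ hz
    have h : ∑ χ : Z →* ℂˣ, (χ z : ℂ) = φ z * ∑ χ : Z →* ℂˣ, (χ z : ℂ) := by
      rw [Finset.mul_sum]
      refine (Fintype.sum_equiv (Equiv.mulLeft φ) _ _ fun χ ↦ ?_).symm
      simp
    have h2 : ((φ z : ℂ) - 1) * ∑ χ : Z →* ℂˣ, (χ z : ℂ) = 0 := by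
      rw [sub_mul, ← h, one_mul, sub_self]
    refine (mul_eq_zero.1 h2).resolve_left fun h3 ↦ hφ ?_
    ext
    simpa [sub_eq_zero] using h3

theorem Representation.trace_eq_sum_finrank_weightSpace [Fintype (Z →* ℂˣ)] {V : Type}
    [AddCommGroup V] [Module ℂ V] [FiniteDimensional ℂ V] (ρ : Representation ℂ Z V) (w : Z) :
    LinearMap.trace ℂ V (ρ w) = ∑ χ, (Module.finrank ℂ (ρ.weightSpace χ) : ℂ) * χ w := by
  classical
  have hcard : (Nat.card Z : ℂ) ≠ 0 := by simp
  refine mul_left_cancel₀ hcard ?_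
  rw [Finset.mul_sum]
  simp_rw [← mul_assoc, ρ.card_mul_finrank_weightSpace, Finset.sum_mul]
  rw [Finset.sum_comm]
  have h : ∀ z, ∑ χ : Z →* ℂˣ,
      ((χ⁻¹ z : ℂˣ) : ℂ) * LinearMap.trace ℂ V (ρ z) * (χ w : ℂ) =
        if w = z then (Nat.card Z : ℂ) * LinearMap.trace ℂ V (ρ z) else 0 := by
    intro z
    have h1 : ∀ χ : Z →* ℂˣ, ((χ⁻¹ z : ℂˣ) : ℂ) * LinearMap.trace ℂ V (ρ z) * (χ w : ℂ) =
        (χ (w * z⁻¹) : ℂ) * LinearMap.trace ℂ V (ρ z) := by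
      intro χ
      rw [map_mul, map_inv, Units.val_mul, MonoidHom.inv_apply]
      ring
    rw [Finset.sum_congr rfl fun χ _ ↦ h1 χ, ← Finset.sum_mul, CommGroup.sum_character_apply]
    simp only [mul_inv_eq_one, ite_mul, zero_mul]
  rw [Finset.sum_congr rfl fun z _ ↦ h z]
  simp

theorem Representation.apply_eq_one_of_weights [Fintype (Z →* ℂˣ)] {V : Type}
    [AddCommGroup V] [Module ℂ V] [FiniteDimensional ℂ V] (ρ : Representation ℂ Z V) {w : Z}
    (hw : ∀ χ, Module.finrank ℂ (ρ.weightSpace χ) ≠ 0 → χ w = 1) : ρ w = 1 := by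
  classical
  let K : Subgroup Z := Subgroup.zpowers w
  have htr : ∀ k : K, LinearMap.trace ℂ V (ρ k) = Module.finrank ℂ V := by
    rintro ⟨k, hk⟩
    obtain ⟨j, rfl⟩ := Subgroup.mem_zpowers_iff.1 hk
    rw [← LinearMap.trace_one (R := ℂ), ← map_one ρ, trace_eq_sum_finrank_weightSpace,
      trace_eq_sum_finrank_weightSpace]
    refine Finset.sum_congr rfl fun χ _ ↦ ?_
    by_cases h : Module.finrank ℂ (ρ.weightSpace χ) = 0
    · simp [h]
    · simp [hw χ h]
  have hcard : (Nat.card K : ℂ) ≠ 0 := by simp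
  have h := card_mul_finrank_weightSpace (ρ.comp K.subtype : Representation ℂ K V) 1
  have h2 : ∀ k : K, LinearMap.trace ℂ V ((ρ.comp K.subtype) k) = Module.finrank ℂ V := htr
  have hone : ∀ k : K, (((1 : K →* ℂˣ)⁻¹ k : ℂˣ) : ℂ) = 1 := fun k ↦ by
    rw [MonoidHom.inv_apply, MonoidHom.one_apply, inv_one, Units.val_one]
  simp only [hone, one_mul, h2, Finset.sum_const, Finset.card_univ, nsmul_eq_mul,
    ← Nat.card_eq_fintype_card] at h
  have h4 : Module.finrank ℂ (weightSpace (ρ.comp K.subtype : Representation ℂ K V) 1) =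
      Module.finrank ℂ V := by
    exact_mod_cast mul_left_cancel₀ hcard h
  have h3 := Submodule.eq_top_of_finrank_eq h4
  ext v
  have hv : v ∈ weightSpace (ρ.comp K.subtype : Representation ℂ K V) 1 := by
    rw [h3]; trivial
  simpa using hv ⟨w, Subgroup.mem_zpowers w⟩

/-- Galois invariance: if a rational combination of the values of a character is an integer,
replacing the character by a power coprime to the order does not change it. -/
theorem MonoidHom.sum_pow_eq_of_sum_eq (f : Z → ℤ) (χ : Z →* ℂˣ) (m : ℤ) {k : ℕ}
    (hk : k.Coprime (Nat.card Z)) (h : ∑ z, (f z : ℂ) * χ z = m) :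
    ∑ z, (f z : ℂ) * (χ ^ k) z = m := by
  have hN : Nat.card Z ≠ 0 := Nat.card_pos.ne'
  have : NeZero (Nat.card Z) := ⟨hN⟩
  have hζ := Complex.isPrimitiveRoot_exp (Nat.card Z) hN
  set ζ := Complex.exp (2 * Real.pi * Complex.I / (Nat.card Z : ℕ))
  have hex : ∀ z, ∃ j : ℕ, ζ ^ j = χ z := by
    intro z
    obtain ⟨j, -, hj⟩ := hζ.eq_pow_of_pow_eq_one (ξ := (χ z : ℂ)) (by
      rw [← Units.val_pow_eq_pow_val, ← map_pow, pow_card_eq_one', map_one, Units.val_one])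
    exact ⟨j, hj⟩
  choose j hj using hex
  let P : Polynomial ℤ := ∑ z, Polynomial.C (f z) * Polynomial.X ^ j z - Polynomial.C m
  have hP : ∀ x : ℂ, Polynomial.aeval x P = ∑ z, (f z : ℂ) * x ^ j z - m := by
    intro x
    simp [P]
  have h0 : Polynomial.aeval ζ P = 0 := by
    rw [hP, sub_eq_zero, ← h]
    simp only [hj]
  have hdvd := minpoly.isIntegrallyClosed_dvd (hζ.isIntegral (Nat.pos_of_ne_zero hN)) h0
  rw [hζ.minpoly_eq_pow_coprime hk] at hdvd
  obtain ⟨Q, hQ⟩ := hdvd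
  have h1 : Polynomial.aeval (ζ ^ k) P = 0 := by
    rw [hQ, map_mul, minpoly.aeval, zero_mul]
  rw [hP, sub_eq_zero] at h1
  rw [← h1]
  refine Finset.sum_congr rfl fun z _ ↦ ?_
  rw [MonoidHom.pow_apply, Units.val_pow_eq_pow_val, ← hj, pow_right_comm]

end WeightSpaces

section MinimalFaithful

variable {Z : Type} [CommGroup Z] {p : ℕ}

/-- A jointly faithful set `S` of characters of a finite abelian `p`-group which is minimal, in the
form that the restrictions of `S` to the elements killed by `p` admit a dual family. -/
structure IsMinimalFaithful (p : ℕ) (S : Finset (Z →* ℂˣ)) : Prop where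
  eq_one : ∀ z, (∀ χ ∈ S, χ z = 1) → z = 1
  exists_dual : ∀ χ ∈ S, ∃ w, w ^ p = 1 ∧ χ w ≠ 1 ∧ ∀ μ ∈ S, μ ≠ χ → μ w = 1

theorem IsPGroup.exists_pow_ne_one_pow_prime_eq_one {G : Type} [Group G] {p : ℕ}
    (hG : IsPGroup p G) {z : G} (hz : z ≠ 1) :
    ∃ n, z ^ n ≠ 1 ∧ (z ^ n) ^ p = 1 := by
  classical
  have hex := hG z
  have hpos : Nat.find hex ≠ 0 := fun h0 ↦ hz (by simpa [h0] using Nat.find_spec hex)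
  obtain ⟨k, hk⟩ := Nat.exists_eq_succ_of_ne_zero hpos
  refine ⟨p ^ k, Nat.find_min hex (by omega), ?_⟩
  rw [← pow_mul, ← pow_succ]
  simpa [hk] using Nat.find_spec hex

theorem IsPGroup.exists_isMinimalFaithful (hZ : IsPGroup p Z) (s : Finset (Z →* ℂˣ))
    (hs : ∀ z, (∀ χ ∈ s, χ z = 1) → z = 1) : ∃ S ⊆ s, IsMinimalFaithful p S := by
  classical
  obtain ⟨S, hSs, hS⟩ := exists_minimal_le_of_wellFoundedLT
    (fun s : Finset (Z →* ℂˣ) ↦ ∀ z, (∀ χ ∈ s, χ z = 1) → z = 1) s hs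
  refine ⟨S, hSs, hS.prop, fun χ hχ ↦ ?_⟩
  have h : ∃ z, (∀ μ ∈ S.erase χ, μ z = 1) ∧ z ≠ 1 := by
    by_contra! hcon
    exact Finset.notMem_erase χ S (hS.le_of_le hcon (Finset.erase_subset χ S) hχ)
  obtain ⟨z, hz, hz1⟩ := h
  obtain ⟨n, hn, hnp⟩ := hZ.exists_pow_ne_one_pow_prime_eq_one hz1
  have hμ : ∀ μ ∈ S, μ ≠ χ → μ (z ^ n) = 1 := fun μ hμ hne ↦ by
    rw [map_pow, hz μ (Finset.mem_erase.2 ⟨hne, hμ⟩), one_pow]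
  refine ⟨z ^ n, hnp, fun h1 ↦ hn (hS.prop _ fun μ hμS ↦ ?_), hμ⟩
  obtain rfl | hne := eq_or_ne μ χ
  exacts [h1, hμ μ hμS hne]

theorem IsPGroup.exists_orderOf_character_eq [Fintype Z] [Fact p.Prime]
    (hZ : IsPGroup p Z) {χ : Z →* ℂˣ} (hχ : χ ≠ 1) :
    ∃ a, orderOf χ = p ^ (a + 1) := by
  obtain ⟨n, hn⟩ := IsPGroup.iff_card.1 hZ
  have hdvd : orderOf χ ∣ p ^ n := by
    rw [← hn]
    refine orderOf_dvd_of_pow_eq_one ?_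
    ext z
    rw [MonoidHom.pow_apply, ← map_pow, pow_card_eq_one', map_one, MonoidHom.one_apply]
  obtain ⟨_ | a, -, ha⟩ := (Nat.dvd_prime_pow (Fact.out : p.Prime)).1 hdvd
  · exact absurd (orderOf_eq_one_iff.1 (by simpa using ha)) hχ
  · exact ⟨a, ha⟩

theorem IsMinimalFaithful.exists_pow_eq_one {S : Finset (Z →* ℂˣ)} (hS : IsMinimalFaithful p S) :
    ∃ w : Z, w ^ p = 1 ∧ ∀ χ ∈ S, χ w ≠ 1 := by
  choose! d hd hdχ hdμ using hS.exists_dual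
  refine ⟨∏ μ ∈ S, d μ, ?_, fun χ hχ ↦ ?_⟩
  · rw [← Finset.prod_pow]
    exact Finset.prod_eq_one hd
  · rw [map_prod, Finset.prod_eq_single_of_mem χ hχ fun μ hμ hne ↦ hdμ μ hμ χ hχ hne.symm]
    exact hdχ χ hχ

theorem MonoidHom.pow_ne_one_of_coprime {χ : Z →* ℂˣ} {w : Z} (hw : w ^ p = 1) (hχ : χ w ≠ 1)
    {k : ℕ} (hk : k.Coprime p) : (χ ^ k) w ≠ 1 := by
  intro h
  rw [MonoidHom.pow_apply] at h
  refine hχ (orderOf_eq_one_iff.1 (Nat.eq_one_of_dvd_coprimes hk (orderOf_dvd_of_pow_eq_one h)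
    (orderOf_dvd_of_pow_eq_one ?_)))
  rw [← map_pow, hw, map_one]

theorem geom_sum_eq_zero_of_pow_eq_one {x : ℂ} (hx : x ≠ 1) {n : ℕ} (hn : x ^ n = 1) :
    ∑ k ∈ Finset.range n, x ^ k = 0 := by
  rw [geom_sum_eq hx, hn, sub_self, zero_div]

theorem sum_le_mul_sum_filter_of_eq_sum_character [Fact p.Prime] [Fintype (Z →* ℂˣ)]
    {m : (Z →* ℂˣ) → ℕ} {t : Z → ℕ} (ht : ∀ z, (t z : ℂ) = ∑ χ, (m χ : ℂ) * χ z) {w : Z}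
    (hw : w ^ p = 1) :
    t 1 ≤ p * ∑ χ with χ w = 1, m χ := by
  classical
  have hsum : ∑ k ∈ Finset.range p, t (w ^ k) = p * ∑ χ with χ w = 1, m χ := by
    have h : ∀ χ : Z →* ℂˣ, ∑ k ∈ Finset.range p, (m χ : ℂ) * χ (w ^ k) =
        if χ w = 1 then (p * m χ : ℂ) else 0 := by
      intro χ
      simp only [map_pow, Units.val_pow_eq_pow_val, ← Finset.mul_sum]
      split_ifs with h1
      · simp [h1, mul_comm]
      · rw [geom_sum_eq_zero_of_pow_eq_one (by simpa using h1), mul_zero]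
        rw [← Units.val_pow_eq_pow_val, ← map_pow, hw, map_one, Units.val_one]
    have h2 : ((∑ k ∈ Finset.range p, t (w ^ k) : ℕ) : ℂ) =
        ((p * ∑ χ with χ w = 1, m χ : ℕ) : ℂ) := by
      push_cast
      simp only [ht]
      rw [Finset.sum_comm, Finset.sum_congr rfl fun χ _ ↦ h χ, Finset.mul_sum, Finset.sum_filter]
    exact_mod_cast h2
  rw [← hsum]
  simpa using Finset.single_le_sum (f := fun k ↦ t (w ^ k)) (fun _ _ ↦ Nat.zero_le _)
    (Finset.mem_range.2 (Fact.out : p.Prime).pos)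

variable [Fintype Z] [Fact p.Prime]

theorem IsMinimalFaithful.mul_sum_totient_le [Fintype (Z →* ℂˣ)]
    (hZ : IsPGroup p Z) {S : Finset (Z →* ℂˣ)} (hS : IsMinimalFaithful p S) {m : (Z →* ℂˣ) → ℕ}
    (hgal : ∀ χ k, k.Coprime p → m (χ ^ k) = m χ) (hSm : ∀ χ ∈ S, m χ ≠ 0)
    {w : Z} (hw : w ^ p = 1) (hSw : ∀ χ ∈ S, χ w ≠ 1)
    {e : ℕ} (he : ∀ χ : Z →* ℂˣ, χ w ≠ 1 → e ∣ m χ) :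
    e * ∑ χ ∈ S, (orderOf χ).totient ≤ ∑ χ with χ w ≠ 1, m χ := by
  classical
  let orb : (Z →* ℂˣ) → Finset (Z →* ℂˣ) := fun χ ↦
    {k ∈ Finset.range (orderOf χ) | (orderOf χ).Coprime k}.image (χ ^ ·)
  have hcop : ∀ χ ∈ S, ∀ k, (orderOf χ).Coprime k → k.Coprime p := by
    intro χ hχ k hk
    obtain ⟨a, ha⟩ := hZ.exists_orderOf_character_eq (χ := χ) (by
      rintro rfl
      exact hSw _ hχ rfl)
    rw [ha] at hk
    exact ((Nat.coprime_pow_left_iff (Nat.succ_pos a) _ _).1 hk).symm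
  have horb : ∀ χ ∈ S, ∀ ψ ∈ orb χ, ∃ k, k.Coprime p ∧ χ ^ k = ψ := by
    intro χ hχ ψ hψ
    obtain ⟨k, hk, rfl⟩ := Finset.mem_image.1 hψ
    exact ⟨k, hcop χ hχ k (Finset.mem_filter.1 hk).2, rfl⟩
  have hdisj : (S : Set (Z →* ℂˣ)).PairwiseDisjoint orb := by
    intro χ hχ μ hμ hne
    refine Finset.disjoint_left.2 fun ψ hψ hψ' ↦ ?_
    obtain ⟨k, hk, rfl⟩ := horb χ hχ ψ hψ
    obtain ⟨l, -, hl⟩ := horb μ hμ _ hψ'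
    obtain ⟨x, hx, hχx, hμx⟩ := hS.exists_dual χ hχ
    refine MonoidHom.pow_ne_one_of_coprime hx hχx hk ?_
    rw [← hl, MonoidHom.pow_apply, hμx μ hμ hne.symm, one_pow]
  have hsub : S.biUnion orb ⊆ Finset.univ.filter fun χ ↦ χ w ≠ 1 := by
    intro ψ hψ
    obtain ⟨χ, hχ, hψχ⟩ := Finset.mem_biUnion.1 hψ
    obtain ⟨k, hk, rfl⟩ := horb χ hχ ψ hψχ
    simpa using MonoidHom.pow_ne_one_of_coprime hw (hSw χ hχ) hk
  refine le_trans ?_ (Finset.sum_le_sum_of_subset hsub)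
  rw [Finset.sum_biUnion hdisj, Finset.mul_sum]
  refine Finset.sum_le_sum fun χ hχ ↦ ?_
  have hcard : (orb χ).card = (orderOf χ).totient := by
    refine Finset.card_image_of_injOn fun k hk l hl h ↦ ?_
    refine pow_injOn_Iio_orderOf (x := χ) ?_ ?_ h
    · simpa using (Finset.mem_filter.1 hk).1
    · simpa using (Finset.mem_filter.1 hl).1
  rw [mul_comm, ← hcard]
  refine Finset.card_nsmul_le_sum _ _ _ fun ψ hψ ↦ ?_
  obtain ⟨k, hk, rfl⟩ := horb χ hχ ψ hψ
  refine Nat.le_of_dvd (Nat.pos_of_ne_zero ?_)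
    (he _ (MonoidHom.pow_ne_one_of_coprime hw (hSw χ hχ) hk))
  rw [hgal χ k hk]
  exact hSm χ hχ

theorem IsMinimalFaithful.mul_sum_orderOf_le [Fintype (Z →* ℂˣ)]
    (hZ : IsPGroup p Z) {S : Finset (Z →* ℂˣ)} (hS : IsMinimalFaithful p S) {m : (Z →* ℂˣ) → ℕ}
    {t : Z → ℕ} (ht : ∀ z, (t z : ℂ) = ∑ χ, (m χ : ℂ) * χ z)
    (hgal : ∀ χ k, k.Coprime p → m (χ ^ k) = m χ) (hSm : ∀ χ ∈ S, m χ ≠ 0)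
    {e : ℕ} (he : ∀ (χ : Z →* ℂˣ) (w : Z), w ^ p = 1 → χ w ≠ 1 → e ∣ m χ) :
    e * ∑ χ ∈ S, orderOf χ ≤ t 1 := by
  classical
  have hp : p.Prime := Fact.out
  obtain ⟨w, hw, hSw⟩ := hS.exists_pow_eq_one
  have h1 := sum_le_mul_sum_filter_of_eq_sum_character ht hw
  have h2 := hS.mul_sum_totient_le hZ hgal hSm hw hSw fun χ ↦ he χ w hw
  have h3 : t 1 = ∑ χ with χ w = 1, m χ + ∑ χ with χ w ≠ 1, m χ := by
    rw [Finset.sum_filter_add_sum_filter_not]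
    have := ht 1
    simp only [map_one, Units.val_one, mul_one] at this
    exact_mod_cast this
  have h4 : p * ∑ χ ∈ S, (orderOf χ).totient = (p - 1) * ∑ χ ∈ S, orderOf χ := by
    rw [Finset.mul_sum, Finset.mul_sum]
    refine Finset.sum_congr rfl fun χ hχ ↦ ?_
    obtain ⟨a, ha⟩ := hZ.exists_orderOf_character_eq (χ := χ) (by
      rintro rfl
      exact hSw _ hχ rfl)
    rw [ha, Nat.totient_prime_pow_succ hp, pow_succ]
    ring
  obtain ⟨q, rfl⟩ : ∃ q, p = q + 2 := ⟨p - 2, by have := hp.two_le; omega⟩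
  rw [show q + 2 - 1 = q + 1 by omega] at h4
  refine le_of_mul_le_mul_left (a := q + 1) ?_ (Nat.succ_pos q)
  generalize ∑ χ ∈ S, (orderOf χ).totient = T at *
  generalize ∑ χ ∈ S, orderOf χ = O at *
  nlinarith

end MinimalFaithful

section QuasiPermutation

/-- The sum of the powers of a `p ^ (a + 1)`-th root of unity, with the exponents divisible by `p`
replaced by `0`, is a natural number. -/
theorem exists_natCast_eq_sum_ite_pow {p : ℕ} (hp : p.Prime) {a : ℕ} {x : ℂ}
    (hx : x ^ p ^ (a + 1) = 1) :
    ∃ N : ℕ, ∑ k ∈ Finset.range (p ^ (a + 1)), (if p ∣ k then 1 else x ^ k) = (N : ℂ) := by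
  have himage : (Finset.range (p ^ (a + 1))).filter (p ∣ ·) =
      (Finset.range (p ^ a)).image (p * ·) := by
    ext k
    simp only [Finset.mem_filter, Finset.mem_range, Finset.mem_image, pow_succ']
    constructor
    · rintro ⟨hk, q, rfl⟩
      exact ⟨q, lt_of_mul_lt_mul_left hk (Nat.zero_le _), rfl⟩
    · rintro ⟨q, hq, rfl⟩
      exact ⟨Nat.mul_lt_mul_of_pos_left hq hp.pos, dvd_mul_right _ _⟩
  have hdvd : ∀ g : ℕ → ℂ, ∑ k ∈ Finset.range (p ^ (a + 1)), (if p ∣ k then g k else 0) =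
      ∑ q ∈ Finset.range (p ^ a), g (p * q) := by
    intro g
    rw [← Finset.sum_filter, himage, Finset.sum_image]
    exact fun _ _ _ _ h ↦ Nat.eq_of_mul_eq_mul_left hp.pos h
  have hsplit : ∑ k ∈ Finset.range (p ^ (a + 1)), (if p ∣ k then 1 else x ^ k) =
      ∑ k ∈ Finset.range (p ^ (a + 1)), x ^ k + p ^ a -
        ∑ q ∈ Finset.range (p ^ a), (x ^ p) ^ q := by
    have h1 := hdvd fun _ ↦ 1
    have h2 := hdvd fun k ↦ x ^ k
    simp only [Finset.sum_const, Finset.card_range, nsmul_eq_mul, mul_one, Nat.cast_pow,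
      pow_mul] at h1 h2
    rw [← h1, ← h2, ← Finset.sum_add_distrib, ← Finset.sum_sub_distrib]
    refine Finset.sum_congr rfl fun k _ ↦ ?_
    split_ifs <;> ring
  by_cases h1 : x = 1
  · exact ⟨p ^ (a + 1), by simp [h1]⟩
  rw [hsplit, geom_sum_eq_zero_of_pow_eq_one h1 hx, zero_add]
  by_cases h2 : x ^ p = 1
  · exact ⟨0, by simp [h2]⟩
  · refine ⟨p ^ a, ?_⟩
    rw [geom_sum_eq_zero_of_pow_eq_one h2 (by rwa [← pow_mul, ← pow_succ']), sub_zero, Nat.cast_pow]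

variable {G Z : Type} [Group G] [CommGroup Z]

/-- `n` is the degree of a faithful quasi-permutation representation of `G` over `ℂ`. -/
def IsQuasiPermDegree (G : Type) [Group G] (n : ℕ) : Prop :=
  0 < n ∧ ∃ ρ : G →* Matrix.GeneralLinearGroup (Fin n) ℂ, Function.Injective ρ ∧
    ∀ g : G, ∃ m : ℕ, Matrix.trace ((ρ g : Matrix (Fin n) (Fin n) ℂ)) = (m : ℂ)

theorem cDeg_eq_sInf (G : Type) [Group G] : cDeg G = sInf {n | IsQuasiPermDegree G n} := rfl

theorem isQuasiPermDegree_card {κ : Type} [Fintype κ] [DecidableEq κ] [Nonempty κ]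
    (R : G →* Matrix κ κ ℂ) (hR : ∀ g, R g = 1 → g = 1)
    (htr : ∀ g, ∃ m : ℕ, (R g).trace = m) : IsQuasiPermDegree G (Fintype.card κ) := by
  let E := Matrix.reindexAlgEquiv ℂ ℂ (Fintype.equivFin κ)
  refine ⟨Fintype.card_pos, ((E : _ →* _).comp R).toHomUnits, ?_, fun g ↦ ?_⟩
  · refine (injective_iff_map_eq_one _).2 fun g hg ↦ hR g (E.injective ?_)
    rw [map_one]
    exact congrArg Units.val hg
  · obtain ⟨m, hm⟩ := htr g
    refine ⟨m, ?_⟩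
    rw [← hm]
    exact (Fintype.equivFin κ).symm.sum_comp fun i ↦ R g i i

variable [Fintype Z] {p : ℕ} [Fact p.Prime] {ι : Z →* G} {e : ℕ}

theorem IsMinimalFaithful.isQuasiPermDegree [Nontrivial Z] (hZ : IsPGroup p Z) (he : 0 < e)
    (hrep : ∀ (χ : Z →* ℂˣ) (w : Z), w ^ p = 1 → χ w ≠ 1 →
      ∃ R : G →* Matrix (Fin e) (Fin e) ℂ, (∀ z, R (ι z) = (χ z : ℂ) • 1) ∧
        ∀ g ∉ ι.range, (R g).trace = 0)
    {S : Finset (Z →* ℂˣ)} (hS : IsMinimalFaithful p S) :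
    IsQuasiPermDegree G (e * ∑ χ ∈ S, orderOf χ) := by
  classical
  have : NeZero e := ⟨he.ne'⟩
  obtain ⟨w, hw, hSw⟩ := hS.exists_pow_eq_one
  have hrep' : ∀ (χ : S) (k : ℕ), ∃ R : G →* Matrix (Fin e) (Fin e) ℂ,
      (∀ z, R (ι z) = (if p ∣ k then 1 else (χ.1 z : ℂ) ^ k) • 1) ∧
        ∀ g ∉ ι.range, (R g).trace = if p ∣ k then (e : ℂ) else 0 := by
    intro χ k
    by_cases hk : p ∣ k
    · exact ⟨1, fun z ↦ by simp [hk], fun g _ ↦ by simp [hk]⟩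
    · have hcop := ((Fact.out : p.Prime).coprime_iff_not_dvd.2 hk).symm
      obtain ⟨R, hR, hR'⟩ := hrep (χ.1 ^ k) w hw
        (MonoidHom.pow_ne_one_of_coprime hw (hSw χ χ.2) hcop)
      refine ⟨R, fun z ↦ ?_, fun g hg ↦ ?_⟩
      · rw [hR, if_neg hk, MonoidHom.pow_apply, Units.val_pow_eq_pow_val]
      · rw [hR' g hg, if_neg hk]
  choose R hRι hRtr using hrep'
  have hord : ∀ χ : S, ∃ a, orderOf χ.1 = p ^ (a + 1) := fun χ ↦
    hZ.exists_orderOf_character_eq fun h ↦ hSw χ χ.2 (by rw [h, MonoidHom.one_apply])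
  let J := Σ χ : S, Fin (orderOf χ.1)
  let T : G →* Matrix (Fin e × J) (Fin e × J) ℂ :=
    ((Matrix.blockDiagonalRingHom (Fin e) J ℂ : _ →+* _) : _ →* _).comp
      (MonoidHom.pi fun j : J ↦ R j.1 j.2)
  have hT : ∀ g, T g = Matrix.blockDiagonal fun j : J ↦ R j.1 j.2 g := fun _ ↦ rfl
  have hcard : Fintype.card (Fin e × J) = e * ∑ χ ∈ S, orderOf χ := by
    simp [J, Finset.sum_attach S fun χ ↦ orderOf χ]
  have hne : Nonempty J := by
    obtain ⟨z, hz⟩ := exists_ne (1 : Z)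
    by_contra hJ
    refine hz (hS.eq_one z fun χ hχ ↦ absurd ⟨(⟨⟨χ, hχ⟩, ⟨0, ?_⟩⟩ : J)⟩ hJ)
    exact orderOf_pos χ
  rw [← hcard]
  refine isQuasiPermDegree_card T (fun g hg ↦ ?_) fun g ↦ ?_
  · have hg' : ∀ j : J, R j.1 j.2 g = 1 := by
      have h : (fun j : J ↦ R j.1 j.2 g) = fun _ ↦ 1 :=
        Matrix.blockDiagonal_injective (by rw [← hT, hg]; exact Matrix.blockDiagonal_one.symm)
      exact congrFun h
    have hR1 : ∀ χ : S, R χ 1 g = 1 := by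
      intro χ
      obtain ⟨a, ha⟩ := hord χ
      exact hg' ⟨χ, ⟨1, by
        rw [ha]
        exact Nat.one_lt_pow a.succ_ne_zero (Fact.out : p.Prime).one_lt⟩⟩
    have hp1 : ¬ p ∣ 1 := (Fact.out : p.Prime).one_lt.ne' ∘ Nat.dvd_one.1
    obtain ⟨⟨χ, -⟩⟩ := hne
    have hgι : g ∈ ι.range := by
      by_contra hgι
      have h := hRtr χ 1 g hgι
      rw [hR1, if_neg hp1, Matrix.trace_one, Fintype.card_fin] at h
      exact he.ne' (by exact_mod_cast h)
    obtain ⟨z, rfl⟩ := hgι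
    rw [hS.eq_one z fun χ hχ ↦ ?_, map_one]
    have h := (hRι ⟨χ, hχ⟩ 1 z).symm.trans (hR1 _)
    rw [if_neg hp1, pow_one] at h
    have h0 := congrFun (congrFun h 0) 0
    ext
    simpa using h0
  · rw [hT, Matrix.trace_blockDiagonal]
    have hcast : ∀ f : J → ℂ, (∀ j, ∃ m : ℕ, f j = m) → ∃ m : ℕ, ∑ j, f j = m := by
      intro f hf
      choose m hm using hf
      exact ⟨∑ j, m j, by simp [hm]⟩
    by_cases hgι : g ∈ ι.range
    · obtain ⟨z, rfl⟩ := hgι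
      simp only [hRι, Matrix.trace_smul, Matrix.trace_one, Fintype.card_fin, smul_eq_mul]
      rw [← Finset.sum_mul, Fintype.sum_sigma]
      have h : ∀ χ : S, ∃ N : ℕ, ∑ k : Fin (orderOf χ.1),
          (if p ∣ (k : ℕ) then 1 else (χ.1 z : ℂ) ^ (k : ℕ)) = N := by
        intro χ
        obtain ⟨a, ha⟩ := hord χ
        rw [Fin.sum_univ_eq_sum_range fun k ↦ if p ∣ k then 1 else (χ.1 z : ℂ) ^ k, ha]
        refine exists_natCast_eq_sum_ite_pow Fact.out ?_
        rw [← ha, ← Units.val_pow_eq_pow_val, ← MonoidHom.pow_apply, pow_orderOf_eq_one,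
          MonoidHom.one_apply, Units.val_one]
      choose N hN using h
      exact ⟨(∑ χ, N χ) * e, by simp [hN]⟩
    · refine hcast _ fun j ↦ ?_
      rw [hRtr _ _ g hgι]
      exact ⟨if p ∣ (j.2 : ℕ) then e else 0, by split_ifs <;> simp⟩

theorem Representation.finrank_weightSpace_pow {V : Type} [AddCommGroup V] [Module ℂ V]
    [FiniteDimensional ℂ V] (ρ : Representation ℂ Z V) {t : Z → ℕ}
    (ht : ∀ z, LinearMap.trace ℂ V (ρ z) = t z) (χ : Z →* ℂˣ) {k : ℕ}
    (hk : k.Coprime (Nat.card Z)) :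
    Module.finrank ℂ (ρ.weightSpace (χ ^ k)) = Module.finrank ℂ (ρ.weightSpace χ) := by
  have h : ∀ χ : Z →* ℂˣ, ∑ z, ((t z : ℤ) : ℂ) * (χ⁻¹ z : ℂˣ) =
      ((Nat.card Z * Module.finrank ℂ (ρ.weightSpace χ) : ℕ) : ℤ) := by
    intro χ
    push_cast
    rw [ρ.card_mul_finrank_weightSpace]
    exact Finset.sum_congr rfl fun z _ ↦ by rw [ht, mul_comm]
  have h1 := MonoidHom.sum_pow_eq_of_sum_eq (fun z ↦ (t z : ℤ)) χ⁻¹ _ hk (h χ)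
  have hinv : χ⁻¹ ^ k = (χ ^ k)⁻¹ := by
    ext z
    simp
  rw [hinv, h] at h1
  exact Nat.eq_of_mul_eq_mul_left Nat.card_pos (by exact_mod_cast h1)

theorem IsQuasiPermDegree.exists_isMinimalFaithful (hZ : IsPGroup p Z)
    (hι : Function.Injective ι)
    (hdvd : ∀ (n : ℕ) (ρ : Representation ℂ G (Fin n → ℂ)) (χ : Z →* ℂˣ) (w : Z), w ^ p = 1 →
      χ w ≠ 1 → e ∣ Module.finrank ℂ
        (Representation.weightSpace (ρ.comp ι : Representation ℂ Z (Fin n → ℂ)) χ))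
    {n : ℕ} (hn : IsQuasiPermDegree G n) :
    ∃ S : Finset (Z →* ℂˣ), IsMinimalFaithful p S ∧ e * ∑ χ ∈ S, orderOf χ ≤ n := by
  classical
  have : Fintype (Z →* ℂˣ) := Fintype.ofFinite _
  obtain ⟨-, ρ, hρ, hρt⟩ := hn
  choose t ht using hρt
  let E := Matrix.toLinAlgEquiv' (R := ℂ) (n := Fin n)
  let σ : Representation ℂ G (Fin n → ℂ) := (E : _ →* _).comp ((Units.coeHom _).comp ρ)
  let τ : Representation ℂ Z (Fin n → ℂ) := σ.comp ι
  have hτ : ∀ z, LinearMap.trace ℂ _ (τ z) = t (ι z) := fun z ↦ by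
    rw [← ht]
    exact Matrix.trace_toLin'_eq _
  have hτ1 : ∀ z, τ z = 1 → z = 1 := fun z hz ↦ by
    refine hι (hρ (Units.ext (E.injective (hz.trans ?_))))
    simp
  let m : (Z →* ℂˣ) → ℕ := fun χ ↦ Module.finrank ℂ (τ.weightSpace χ)
  obtain ⟨S, hSm, hS⟩ := hZ.exists_isMinimalFaithful (Finset.univ.filter fun χ ↦ m χ ≠ 0) fun z hz ↦
    hτ1 z (τ.apply_eq_one_of_weights fun χ hχ ↦ hz χ (Finset.mem_filter.2 ⟨Finset.mem_univ χ, hχ⟩))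
  refine ⟨S, hS, ?_⟩
  have hle := hS.mul_sum_orderOf_le hZ (m := m) (t := fun z ↦ t (ι z)) (e := e)
    (fun z ↦ by rw [← hτ, τ.trace_eq_sum_finrank_weightSpace])
    (fun χ k hk ↦ τ.finrank_weightSpace_pow hτ χ (by
      obtain ⟨a, ha⟩ := IsPGroup.iff_card.1 hZ
      rw [ha]
      exact hk.pow_right a))
    (fun χ hχ ↦ (Finset.mem_filter.1 (hSm hχ)).2) fun χ w hw hχ ↦ hdvd n σ χ w hw hχ
  have h1 : (t (ι 1) : ℂ) = n := by rw [← ht]; simp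
  rwa [show t (ι 1) = n by exact_mod_cast h1] at hle

theorem cDeg_eq_mul_sInf [Nontrivial Z] (hZ : IsPGroup p Z)
    (hι : Function.Injective ι) (he : 0 < e)
    (hrep : ∀ (χ : Z →* ℂˣ) (w : Z), w ^ p = 1 → χ w ≠ 1 →
      ∃ R : G →* Matrix (Fin e) (Fin e) ℂ, (∀ z, R (ι z) = (χ z : ℂ) • 1) ∧
        ∀ g ∉ ι.range, (R g).trace = 0)
    (hdvd : ∀ (n : ℕ) (ρ : Representation ℂ G (Fin n → ℂ)) (χ : Z →* ℂˣ) (w : Z), w ^ p = 1 →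
      χ w ≠ 1 → e ∣ Module.finrank ℂ
        (Representation.weightSpace (ρ.comp ι : Representation ℂ Z (Fin n → ℂ)) χ)) :
    cDeg G = e * sInf {n | ∃ S : Finset (Z →* ℂˣ), IsMinimalFaithful p S ∧
      ∑ χ ∈ S, orderOf χ = n} := by
  classical
  have : Fintype (Z →* ℂˣ) := Fintype.ofFinite _
  obtain ⟨S₀, -, hS₀⟩ := hZ.exists_isMinimalFaithful Finset.univ fun z hz ↦ by
    by_contra hz1
    obtain ⟨φ, hφ⟩ := CommGroup.exists_apply_ne_one_of_hasEnoughRootsOfUnity Z ℂ hz1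
    exact hφ (hz φ (Finset.mem_univ φ))
  obtain ⟨S, hS, hSeq⟩ := Nat.sInf_mem (s := {n | ∃ S : Finset (Z →* ℂˣ),
    IsMinimalFaithful p S ∧ ∑ χ ∈ S, orderOf χ = n}) ⟨_, S₀, hS₀, rfl⟩
  have hmem := hS.isQuasiPermDegree hZ he hrep
  rw [cDeg_eq_sInf]
  refine le_antisymm (Nat.sInf_le (by rwa [hSeq] at hmem)) ?_
  have hinf : IsQuasiPermDegree G (sInf {n | IsQuasiPermDegree G n}) :=
    Nat.sInf_mem (s := {n | IsQuasiPermDegree G n}) ⟨_, hmem⟩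
  obtain ⟨S', hS', hle⟩ := hinf.exists_isMinimalFaithful hZ hι hdvd
  refine (Nat.mul_le_mul_left e (Nat.sInf_le ?_)).trans hle
  exact ⟨S', hS', rfl⟩

end QuasiPermutation

theorem CommGroup.cDeg_eq_sInf {Z : Type} [CommGroup Z] [Fintype Z] [Nontrivial Z] {p : ℕ}
    [Fact p.Prime] (hZ : IsPGroup p Z) :
    cDeg Z = sInf {n | ∃ S : Finset (Z →* ℂˣ), IsMinimalFaithful p S ∧
      ∑ χ ∈ S, orderOf χ = n} := by
  rw [cDeg_eq_mul_sInf hZ (ι := MonoidHom.id Z) (e := 1) Function.injective_id one_pos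
    (fun χ _ _ _ ↦ ?_) fun _ _ _ _ _ _ ↦ one_dvd _, one_mul]
  refine ⟨((Matrix.scalar (Fin 1) : ℂ →+* _) : ℂ →* _).comp ((Units.coeHom ℂ).comp χ),
    fun z ↦ ?_, fun g hg ↦ absurd ⟨g, rfl⟩ hg⟩
  change Matrix.scalar (Fin 1) (χ z : ℂ) = _
  rw [Matrix.scalar_apply, Matrix.smul_one_eq_diagonal]

theorem cDeg_eq_of_mulEquiv {G H : Type} [Group G] [Group H] (f : G ≃* H) : cDeg G = cDeg H := by
  rw [cDeg_eq_sInf, cDeg_eq_sInf]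
  congr 1
  ext n
  constructor
  · rintro ⟨hn, ρ, hρ, ht⟩
    exact ⟨hn, ρ.comp f.symm, hρ.comp f.symm.injective, fun h ↦ ht (f.symm h)⟩
  · rintro ⟨hn, ρ, hρ, ht⟩
    exact ⟨hn, ρ.comp f, hρ.comp f.injective, fun g ↦ ht (f g)⟩

open scoped IsMulCommutative in
theorem IsVZGroup.cDeg_eq {G : Type} [Group G] [Fintype G] (hVZ : IsVZGroup G) {p : ℕ}
    [Fact p.Prime] (hp : IsPGroup p G) [Nontrivial (Subgroup.center G)] {e : ℕ}
    (he : e * e = (Subgroup.center G).index)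
    (hw : ∀ w : Subgroup.center G, w ^ p = 1 → (w : G) ∈ commutator G) :
    cDeg G = e * cDeg (Subgroup.center G) := by
  have hZ := hp.to_subgroup (Subgroup.center G)
  have : Fintype (Subgroup.center G) := Fintype.ofFinite _
  have he0 : 0 < e := Nat.pos_of_ne_zero fun h0 ↦
    (Subgroup.center G).index_ne_zero_of_finite (by rw [← he, h0])
  rw [CommGroup.cDeg_eq_sInf hZ]
  refine cDeg_eq_mul_sInf hZ (ι := (Subgroup.center G).subtype) (Subgroup.subtype_injective _) he0
    (fun χ w hwp hχ ↦ ?_) fun n ρ χ w hwp hχ ↦ ?_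
  · rw [Subgroup.range_subtype]
    exact hVZ.exists_matrix_representation he (hw w hwp) hχ
  · let W : Subrepresentation ρ :=
      { toSubmodule := Representation.weightSpace (ρ.comp (Subgroup.center G).subtype :
          Representation ℂ (Subgroup.center G) (Fin n → ℂ)) χ
        apply_mem_toSubmodule := fun g v hv z ↦ by
          have hz : (z : G) * g = g * z := (Subgroup.mem_center_iff.1 z.2 g).symm
          change ρ z (ρ g v) = _
          rw [← Module.End.mul_apply, ← map_mul, hz, map_mul, Module.End.mul_apply,
            show ρ z v = _ from hv z, map_smul] }
    have hW : W.toRepresentation.HasCentralCharacter χ := fun z v ↦ Subtype.ext (v.2 z)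
    exact hW.dvd_finrank hVZ he (hw w hwp) hχ

/-- If `G` is a finite VZ `p`-group with `d(G') = d(Z(G))`, then
`c(G) = |G : Z(G)|^{1/2} · c(Z(G))`. -/
theorem c_of_VZ_pGroup_rank_eq (p : ℕ) [Fact p.Prime] (G : Type) [Group G] [Fintype G]
    (hp : IsPGroup p G) (hVZ : IsVZGroup G)
    (h : Group.rank ↥(commutator G) = Group.rank ↥(Subgroup.center G)) :
    (cDeg G : ℝ) = Real.sqrt ((Subgroup.center G).index) * cDeg ↥(Subgroup.center G) := by
  obtain hG | hG := subsingleton_or_nontrivial G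
  · have hZ : Subgroup.center G = ⊤ := Subsingleton.elim _ _
    rw [hZ, Subgroup.index_top, Nat.cast_one, Real.sqrt_one, one_mul,
      cDeg_eq_of_mulEquiv Subgroup.topEquiv]
  have hZ : Nontrivial (Subgroup.center G) := hp.center_nontrivial
  have hmem : ∀ w : Subgroup.center G, w ^ p = 1 → (w : G) ∈ commutator G := fun w hw ↦
    hp.mem_of_rank_eq_rank_center hVZ.commutator_le_center h w.2
      (by rw [← Subgroup.coe_pow, hw, Subgroup.coe_one])
  obtain ⟨z, hz⟩ := exists_ne (1 : Subgroup.center G)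
  obtain ⟨n, hn, hnp⟩ :=
    (hp.to_subgroup (Subgroup.center G)).exists_pow_ne_one_pow_prime_eq_one hz
  obtain ⟨e, he⟩ := hVZ.exists_mul_self_eq_index (hmem _ hnp) hn
  rw [hVZ.cDeg_eq hp he hmem, ← he, Nat.cast_mul, Nat.cast_mul,
    Real.sqrt_mul_self (Nat.cast_nonneg e)]
end

section
/- Let p be a prime and let G be a finite VZ p-group with d(Z(G)) = r and d(G') = k. Let X be a set of r irreducible complex characters of G such that the intersection of the kernels of the characters in X is trivial, while for every proper subset Y of X the intersection of the kernels of the characters in Y is nontrivial. Then the number of characters χ ∈ X with χ(1) = 1 is at most r − k. -/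
open CategoryTheory in
/-- An irreducible representation of a finite group gives a simple object of `FDRep`. -/
theorem FDRep.simple_of_isIrreducible {G : Type} [Group G] [Finite G] {V : Type} [AddCommGroup V]
    [Module ℂ V] [FiniteDimensional ℂ V] (ρ : Representation ℂ G V) [ρ.IsIrreducible] :
    Simple (FDRep.of ρ) := by
  have := Fintype.ofFinite G
  have hG : (Nat.card G : ℂ) ≠ 0 := NeZero.ne _
  have := invertibleOfNonzero hG
  rw [FDRep.simple_iff_char_is_norm_one]
  have h := Representation.char_orthonormal ρ ρ
  rw [if_pos ⟨Representation.Equiv.refl ρ⟩, inv_mul_eq_one₀ hG] at h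
  exact h.symm

namespace Representation

variable {G V : Type*} [Group G] [AddCommGroup V] [Module ℂ V] [FiniteDimensional ℂ V]

theorem character_eq_add_of_isCompl (ρ : Representation ℂ G V) {p q : Subrepresentation ρ}
    (h : IsCompl p q) (g : G) :
    ρ.character g = p.toRepresentation.character g + q.toRepresentation.character g := by
  have h' : IsCompl p.toSubmodule q.toSubmodule := by
    constructor
    · rw [disjoint_iff]
      exact congrArg Subrepresentation.toSubmodule (disjoint_iff.1 h.disjoint)
    · rw [codisjoint_iff]
      exact congrArg Subrepresentation.toSubmodule (codisjoint_iff.1 h.codisjoint)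
  have e : ρ g = (Submodule.prodEquivOfIsCompl _ _ h').conj
      ((p.toRepresentation g).prodMap (q.toRepresentation g)) := by
    refine LinearMap.ext fun v => ?_
    obtain ⟨w, rfl⟩ := (Submodule.prodEquivOfIsCompl _ _ h').surjective v
    rw [LinearEquiv.conj_apply_apply, LinearEquiv.symm_apply_apply]
    simp [Subrepresentation.toRepresentation]
  unfold character
  rw [e, LinearMap.trace_conj', LinearMap.trace_prodMap']

/-- If `H` acts by scalars then the character of `ρ`, divided by its degree, is multiplicative
on `H`. -/
theorem exists_monoidHom_character_eq [Nontrivial V] (ρ : Representation ℂ G V) (H : Subgroup G)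
    (hH : ∀ h ∈ H, ∃ c : ℂ, ρ h = c • LinearMap.id) :
    ∃ f : H →* ℂ, ∀ h : H, ρ.character h = f h * Module.finrank ℂ V := by
  choose c hc using fun h : H => hH h h.2
  have hinj : Function.Injective fun a : ℂ => a • (LinearMap.id : V →ₗ[ℂ] V) :=
    smul_left_injective ℂ one_ne_zero
  refine ⟨⟨⟨c, hinj ?_⟩, fun a b => hinj ?_⟩, fun h => ?_⟩
  · simp only [← hc, one_smul, OneMemClass.coe_one, map_one]
    rfl
  · simp only [← hc, Subgroup.coe_mul, map_mul]
    rw [hc a, hc b]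
    ext v
    simp [smul_smul, mul_comm]
  · simp [character, hc]

theorem character_eq_one_of_mem_commutator (ρ : Representation ℂ G V)
    (hV : Module.finrank ℂ V = 1) {g : G} (hg : g ∈ commutator G) : ρ.character g = 1 := by
  have := Module.nontrivial_of_finrank_pos (R := ℂ) (M := V) (by omega)
  obtain ⟨f, hf⟩ := ρ.exists_monoidHom_character_eq ⊤ fun h _ =>
    (LinearMap.existsUnique_eq_smul_id_of_finrank_eq_one hV (ρ h)).exists
  have hk := Abelianization.commutator_subset_ker
    (f.comp Subgroup.topEquiv.symm.toMonoidHom).toHomUnits hg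
  have h1 : f ⟨g, Subgroup.mem_top g⟩ = 1 := congrArg Units.val (MonoidHom.mem_ker.1 hk)
  rw [hf ⟨g, Subgroup.mem_top g⟩, h1, hV]
  simp

/-- The regular representation of a group on its functions. -/
def regularFun (k G : Type*) [CommRing k] [Group G] : Representation k G (G → k) where
  toFun g := LinearMap.funLeft k k (g⁻¹ * ·)
  map_one' := by ext; simp
  map_mul' g h := by ext; simp [LinearMap.funLeft, mul_assoc]

theorem regularFun_apply {k G : Type*} [CommRing k] [Group G] (g : G) (f : G → k) (x : G) :
    regularFun k G g f x = f (g⁻¹ * x) := rfl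

theorem character_regularFun [Finite G] {g : G} (hg : g ≠ 1) :
    (regularFun ℂ G).character g = 0 := by
  classical
  have := Fintype.ofFinite G
  rw [character, LinearMap.trace_eq_matrix_trace ℂ (Pi.basisFun ℂ G), Matrix.trace]
  refine Finset.sum_eq_zero fun x _ => ?_
  simp [regularFun_apply, hg]

end Representation

namespace IsVZGroup

variable {G : Type} [Group G] [Finite G]

theorem exists_character_eq_natCast (hVZ : IsVZGroup G) {g : G} (hg : g ∈ commutator G)
    (hgZ : g ∉ Subgroup.center G) {V : Type} [AddCommGroup V] [Module ℂ V] [FiniteDimensional ℂ V]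
    (ρ : Representation ℂ G V) : ∃ n : ℕ, ρ.character g = n := by
  induction hd : Module.finrank ℂ V using Nat.strong_induction_on generalizing V with
  | _ d ih =>
  subst hd
  rcases subsingleton_or_nontrivial V with hV | hV
  · refine ⟨0, ?_⟩
    rw [Representation.character, Subsingleton.elim (ρ g) 0, map_zero, Nat.cast_zero]
  by_cases hirr : ρ.IsIrreducible
  · by_cases h1 : Module.finrank ℂ V = 1
    · exact ⟨1, by rw [ρ.character_eq_one_of_mem_commutator h1 hg, Nat.cast_one]⟩
    · have hpos := Module.finrank_pos (R := ℂ) (M := V)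
      refine ⟨0, ?_⟩
      rw [Nat.cast_zero]
      exact hVZ (FDRep.of ρ) (FDRep.simple_of_isIrreducible ρ)
        (show 1 < Module.finrank ℂ V by omega) g hgZ
  · have hnt : Nontrivial (Subrepresentation ρ) := by
      refine ⟨⊥, ⊤, fun h => bot_ne_top (α := Submodule ℂ V) ?_⟩
      exact congrArg Subrepresentation.toSubmodule h
    obtain ⟨p, hp0, hp1⟩ : ∃ p : Subrepresentation ρ, p ≠ ⊥ ∧ p ≠ ⊤ := by
      by_contra! h
      exact hirr ⟨fun p => or_iff_not_imp_left.2 (h p)⟩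
    obtain ⟨q, hpq⟩ := exists_isCompl p
    have hlt : ∀ p : Subrepresentation ρ, p ≠ ⊤ →
        Module.finrank ℂ p.toSubmodule < Module.finrank ℂ V := fun p hp =>
      Submodule.finrank_lt fun h => hp (Subrepresentation.toSubmodule_injective h)
    have hq1 : q ≠ ⊤ := fun h => hp0 (by simpa [h] using hpq.inf_eq_bot)
    obtain ⟨a, ha⟩ := ih _ (hlt p hp1) p.toRepresentation rfl
    obtain ⟨b, hb⟩ := ih _ (hlt q hq1) q.toRepresentation rfl
    exact ⟨a + b, by rw [ρ.character_eq_add_of_isCompl hpq, ha, hb, Nat.cast_add]⟩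

theorem commutator_le_center_s9 (hVZ : IsVZGroup G) : commutator G ≤ Subgroup.center G := by
  intro g hg
  by_contra hgZ
  have := Fintype.ofFinite G
  let ρ := Representation.regularFun ℂ G
  let p : Subrepresentation ρ := ⟨ℂ ∙ 1, fun x w hw => by
    obtain ⟨c, rfl⟩ := Submodule.mem_span_singleton.1 hw
    exact hw⟩
  obtain ⟨q, hpq⟩ := exists_isCompl p
  have hp : p.toRepresentation.character g = 1 :=
    p.toRepresentation.character_eq_one_of_mem_commutator (finrank_span_singleton one_ne_zero) hg
  obtain ⟨n, hn⟩ := hVZ.exists_character_eq_natCast hg hgZ q.toRepresentation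
  have h0 := ρ.character_eq_add_of_isCompl hpq g
  rw [Representation.character_regularFun, hp, hn] at h0
  · norm_cast at h0
    omega
  · rintro rfl
    exact hgZ (one_mem _)

end IsVZGroup

open CategoryTheory in
/-- Schur's lemma: the center acts by scalars on a simple representation. -/
theorem FDRep.exists_eq_smul_id_of_mem_center {G : Type} [Group G] (V : FDRep ℂ G) [Simple V]
    {z : G} (hz : z ∈ Subgroup.center G) : ∃ c : ℂ, V.ρ z = c • LinearMap.id := by
  let φ : V ⟶ V := ⟨Action.ρ V z, fun g => by
    rw [← End.mul_def, ← End.mul_def, ← map_mul, ← map_mul, Subgroup.mem_center_iff.1 hz g]⟩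
  obtain ⟨c, hc⟩ := (finrank_eq_one_iff_of_nonzero' (𝟙 V) (id_nonzero V)).1
    (finrank_endomorphism_simple_eq_one ℂ V) φ
  exact ⟨c, congrArg (fun f : V ⟶ V => f.hom.hom.hom) hc.symm⟩

/-- If finitely many characters with values in a domain separate the elements of a subgroup `H` of
a finite group from `1`, then `H` is generated by at most that many elements. -/
theorem Subgroup.exists_closure_eq_card_le {A R ι : Type*} [Group A] [Finite A] [CommRing R]
    [IsDomain R] (f : ι → A →* R) (s : Finset ι) (H : Subgroup A)
    (hH : ∀ h ∈ H, (∀ i ∈ s, f i h = 1) → h = 1) :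
    ∃ T : Finset A, T.card ≤ s.card ∧ Subgroup.closure (T : Set A) = H := by
  classical
  induction s using Finset.induction_on generalizing H with
  | empty =>
    refine ⟨∅, le_rfl, ?_⟩
    rw [Finset.coe_empty, Subgroup.closure_empty, eq_comm, Subgroup.eq_bot_iff_forall]
    exact fun h hh => hH h hh (by simp)
  | insert i s hi ih =>
    let F : H →* Rˣ := (f i).toHomUnits.comp H.subtype
    have hF : ∀ h : H, F h = 1 ↔ f i h = 1 := fun h => by simp [F, Units.ext_iff]
    obtain ⟨T, hT, hTK⟩ := ih (F.ker.map H.subtype) <| by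
      rintro _ ⟨h, hh, rfl⟩ hs
      refine hH _ h.2 fun j hj => ?_
      rcases Finset.mem_insert.1 hj with rfl | hj
      · exact (hF h).1 hh
      · exact hs j hj
    have : Finite F.range := Finite.of_surjective _ F.rangeRestrict_surjective
    have : IsCyclic F.range := isCyclic_subgroup_units F.range
    obtain ⟨⟨_, h₀, rfl⟩, hgen⟩ := IsCyclic.exists_generator (α := F.range)
    refine ⟨insert (h₀ : A) T, ?_, le_antisymm ?_ fun h hh => ?_⟩
    · rw [Finset.card_insert_of_notMem hi]
      exact (Finset.card_insert_le _ _).trans (by omega)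
    · rw [Subgroup.closure_le, Finset.coe_insert, Set.insert_subset_iff]
      refine ⟨h₀.2, fun t ht => ?_⟩
      have : t ∈ F.ker.map H.subtype := hTK ▸ Subgroup.subset_closure ht
      exact Subgroup.map_subtype_le _ this
    · obtain ⟨n, hn⟩ := Subgroup.mem_zpowers_iff.1 (hgen ⟨F ⟨h, hh⟩, ⟨h, hh⟩, rfl⟩)
      have hn' : F h₀ ^ n = F ⟨h, hh⟩ := congrArg Subtype.val hn
      have hk : (⟨h, hh⟩ : H) * (h₀ ^ n)⁻¹ ∈ F.ker := by
        rw [MonoidHom.mem_ker, map_mul, map_inv, map_zpow, hn', mul_inv_cancel]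
      have h1 : h * ((h₀ : A) ^ n)⁻¹ ∈ Subgroup.closure (T : Set A) :=
        hTK ▸ ⟨_, hk, rfl⟩
      have h2 : (h₀ : A) ∈ Subgroup.closure ((insert (h₀ : A) T : Finset A) : Set A) :=
        Subgroup.subset_closure (by simp)
      have h3 := mul_mem (Subgroup.closure_mono (by simp) h1) (zpow_mem h2 n)
      rwa [inv_mul_cancel_right] at h3

theorem IsVZGroup.exists_commutator_monoidHom {G : Type} [Group G] [Finite G] (hVZ : IsVZGroup G)
    (V : FDRep ℂ G) (hV : CategoryTheory.Simple V) :
    ∃ f : commutator G →* ℂ, ∀ a, f a = 1 → V.character a = V.character 1 := by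
  have hnt : Nontrivial V := by
    rw [← not_subsingleton_iff_nontrivial]
    intro h
    refine CategoryTheory.id_nonzero V ?_
    ext v
    exact Subsingleton.elim (α := V) _ _
  obtain ⟨f, hf⟩ := Representation.exists_monoidHom_character_eq V.ρ (commutator G)
    fun h hh => V.exists_eq_smul_id_of_mem_center (hVZ.commutator_le_center_s9 hh)
  refine ⟨f, fun a ha => ?_⟩
  rw [FDRep.char_one]
  exact (hf a).trans (by rw [ha, one_mul])

/-- Let `G` be a finite VZ `p`-group with `d(Z(G)) = r` and `d(G') = k`, and
let `X` be a set of `r` irreducible characters whose kernels intersect trivially, minimally so.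
Then `X` contains at most `r - k` linear characters. -/
theorem linear_characters_le (p : ℕ) [Fact p.Prime] (G : Type) [Group G] [Fintype G]
    (hp : IsPGroup p G) (hVZ : IsVZGroup G) (r k : ℕ)
    (hr : Group.rank ↥(Subgroup.center G) = r)
    (hk : Group.rank ↥(commutator G) = k)
    (X : Set (G → ℂ)) (hcard : X.ncard = r)
    (hirr : ∀ χ ∈ X, ∃ V : FDRep ℂ G, CategoryTheory.Simple V ∧ χ = V.character)
    (hker : ⋂ χ ∈ X, {g : G | χ g = χ 1} = {1})
    (hmin : ∀ Y ⊂ X, ⋂ χ ∈ Y, {g : G | χ g = χ 1} ≠ {1}) :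
    {χ ∈ X | χ 1 = 1}.ncard ≤ r - k := by
  classical
  have hfin : X.Finite := by
    rcases Nat.eq_zero_or_pos r with rfl | hpos
    · have hZ := Group.rank_eq_zero_iff.1 hr
      have hG : Subsingleton G := by
        by_contra h
        have := not_subsingleton_iff_nontrivial.1 h
        exact not_subsingleton_iff_nontrivial.2 hp.center_nontrivial hZ
      rcases X.eq_empty_or_nonempty with rfl | hne
      · exact Set.finite_empty
      · refine absurd ?_ (hmin ∅ hne.empty_ssubset)
        ext g
        simp [Subsingleton.elim g 1]
    · exact Set.finite_of_ncard_pos (hcard ▸ hpos)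
  have hf : ∀ χ : G → ℂ, ∃ f : commutator G →* ℂ,
      χ ∈ X → ∀ a : commutator G, f a = 1 → χ a = χ 1 := by
    intro χ
    by_cases hχ : χ ∈ X
    · obtain ⟨V, hV, rfl⟩ := hirr χ hχ
      obtain ⟨f, h⟩ := hVZ.exists_commutator_monoidHom V hV
      exact ⟨f, fun _ => h⟩
    · exact ⟨1, fun h => absurd h hχ⟩
  choose f hf using hf
  have hlin : ∀ χ ∈ X, χ 1 = 1 → ∀ g ∈ commutator G, χ g = χ 1 := by
    intro χ hχ h1 g hg
    obtain ⟨V, hV, rfl⟩ := hirr χ hχ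
    rw [h1]
    refine Representation.character_eq_one_of_mem_commutator V.ρ ?_ hg
    rw [FDRep.char_one] at h1
    exact_mod_cast h1
  have hN : (X \ {χ ∈ X | χ 1 = 1}).Finite := hfin.sdiff
  obtain ⟨T, hT, hTtop⟩ := Subgroup.exists_closure_eq_card_le f hN.toFinset ⊤ <| by
    intro a _ ha
    have hmem : (a : G) ∈ ⋂ χ ∈ X, {g : G | χ g = χ 1} := by
      refine Set.mem_iInter₂.2 fun χ hχ => ?_
      by_cases h1 : χ 1 = 1
      · exact hlin χ hχ h1 a a.2
      · exact hf χ hχ a (ha χ (by simp [hχ, h1]))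
    rw [hker] at hmem
    exact Subtype.ext hmem
  have hk' : k ≤ (X \ {χ ∈ X | χ 1 = 1}).ncard := by
    rw [← hk, Set.ncard_eq_toFinset_card _ hN]
    exact (Group.rank_le hTtop).trans hT
  have hsum := Set.ncard_sdiff_add_ncard_of_subset (Set.sep_subset X fun χ => χ 1 = 1) hfin
  omega
end
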